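/- arXiv:1606.03021 — 7 statements merged into one kernel-verified Lean document; each statement's English description precedes it below -/
import Mathlib

section
/- Let n ≥ 4, let p̊₁, …, p̊ₙ ∈ ℝ³ be unit vectors containing four vectors every three of which are linearly independent, let k₁, …, kₙ > 0, and let E be a real 3×3 matrix with det(E) = 1. If the aggregate cost Σᵢ (kᵢ/2)·‖E p̊ᵢ/‖E p̊ᵢ‖ − p̊ᵢ‖² equals 0, then E = I. In particular, E = I is the unique zero (hence unique global minimizer) of the aggregate cost on SL(3). -/
open Matrix

/-- The Euclidean norm on `ℝ³` (realized as `Fin 3 → ℝ`). -/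
noncomputable def eNorm3 (x : Fin 3 → ℝ) : ℝ := Real.sqrt (x ⬝ᵥ x)

theorem eNorm3_eq_zero {x : Fin 3 → ℝ} : eNorm3 x = 0 ↔ x = 0 := by
  have hx : 0 ≤ x ⬝ᵥ x := Finset.sum_nonneg fun i _ => mul_self_nonneg (x i)
  rw [eNorm3, Real.sqrt_eq_zero hx, dotProduct_self_eq_zero]

/-- If the aggregate cost vanishes, every direction is an eigenvector. -/
theorem exists_mulVec_eq_smul_of_cost_eq_zero {n : ℕ} {p : Fin n → Fin 3 → ℝ}
    (hp : ∀ i, p i ≠ 0) {k : Fin n → ℝ} (hk : ∀ i, 0 < k i)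
    {E : Matrix (Fin 3) (Fin 3) ℝ}
    (hcost : ∑ i, (k i / 2) *
      eNorm3 ((eNorm3 (E.mulVec (p i)))⁻¹ • E.mulVec (p i) - p i) ^ 2 = 0) (i : Fin n) :
    ∃ c : ℝ, E.mulVec (p i) = c • p i := by
  rw [Finset.sum_eq_zero_iff_of_nonneg
    fun j _ => mul_nonneg (half_pos (hk j)).le (sq_nonneg _)] at hcost
  have hi := (mul_eq_zero.mp (hcost i (Finset.mem_univ i))).resolve_left (half_pos (hk i)).ne'
  have hsub := sub_eq_zero.mp (eNorm3_eq_zero.mp (pow_eq_zero_iff two_ne_zero |>.mp hi))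
  refine ⟨eNorm3 (E.mulVec (p i)), ?_⟩
  have hne : eNorm3 (E.mulVec (p i)) ≠ 0 := by
    intro h
    rw [h, _root_.inv_zero, zero_smul] at hsub
    exact hp i hsub.symm
  exact (inv_smul_eq_iff₀ hne).mp hsub

/-- A `3 × 3` matrix with four eigenvectors in general position is scalar. -/
theorem eq_smul_one_of_four_eigenvectors {E : Matrix (Fin 3) (Fin 3) ℝ}
    {v : Fin 4 → Fin 3 → ℝ}
    (hv : ∀ i j k : Fin 4, i ≠ j → i ≠ k → j ≠ k → LinearIndependent ℝ ![v i, v j, v k])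
    {c : Fin 4 → ℝ} (hE : ∀ i, E.mulVec (v i) = c i • v i) :
    E = c 3 • (1 : Matrix (Fin 3) (Fin 3) ℝ) := by
  have h012 := hv 0 1 2 (by decide) (by decide) (by decide)
  let b := basisOfLinearIndependentOfCardEqFinrank h012 (by simp)
  have hb : ⇑b = ![v 0, v 1, v 2] := coe_basisOfLinearIndependentOfCardEqFinrank h012 _
  obtain ⟨x, y, z, hxyz⟩ : ∃ x y z : ℝ, x • v 0 + y • v 1 + z • v 2 = v 3 := by
    refine ⟨b.repr (v 3) 0, b.repr (v 3) 1, b.repr (v 3) 2, ?_⟩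
    simpa [Fin.sum_univ_three, hb] using b.sum_repr (v 3)
  have hx : x ≠ 0 := by
    rintro rfl
    have h := Fintype.linearIndependent_iff.mp
      (hv 1 2 3 (by decide) (by decide) (by decide)) ![y, z, -1]
      (by simp only [Fin.sum_univ_three, cons_val, ← hxyz]; module) 2
    simp at h
  have hy : y ≠ 0 := by
    rintro rfl
    have h := Fintype.linearIndependent_iff.mp
      (hv 0 2 3 (by decide) (by decide) (by decide)) ![x, z, -1]
      (by simp only [Fin.sum_univ_three, cons_val, ← hxyz]; module) 2
    simp at h
  have hz : z ≠ 0 := by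
    rintro rfl
    have h := Fintype.linearIndependent_iff.mp
      (hv 0 1 3 (by decide) (by decide) (by decide)) ![x, y, -1]
      (by simp only [Fin.sum_univ_three, cons_val, ← hxyz]; module) 2
    simp at h
  have hrel : x • c 0 • v 0 + y • c 1 • v 1 + z • c 2 • v 2 =
      c 3 • (x • v 0 + y • v 1 + z • v 2) := by
    rw [hxyz, ← hE 3, ← hxyz]
    simp only [mulVec_add, mulVec_smul, hE]
  have hcoeff := Fintype.linearIndependent_iff.mp h012
    ![x * (c 0 - c 3), y * (c 1 - c 3), z * (c 2 - c 3)] (by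
      simp only [Fin.sum_univ_three, cons_val]
      rw [← sub_eq_zero.mpr hrel]
      module)
  have h0 : c 0 = c 3 := by simpa [hx, sub_eq_zero] using hcoeff 0
  have h1 : c 1 = c 3 := by simpa [hy, sub_eq_zero] using hcoeff 1
  have h2 : c 2 = c 3 := by simpa [hz, sub_eq_zero] using hcoeff 2
  apply Matrix.toLin'.injective
  refine b.ext fun i => ?_
  rw [hb]
  fin_cases i <;> simp [hE, h0, h1, h2]

/-- For a consistent family of `n ≥ 4` unit directions `p̊ᵢ`, positive
gains `kᵢ`, and `E ∈ SL(3)`, if the aggregate cost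
`∑ᵢ (kᵢ/2)‖E p̊ᵢ/‖E p̊ᵢ‖ − p̊ᵢ‖²` vanishes then `E = I`. -/
theorem stmt_5 (n : ℕ) (hn : 4 ≤ n) (p : Fin n → Fin 3 → ℝ)
    (hunit : ∀ i, eNorm3 (p i) = 1)
    (hcons : ∃ a : Fin 4 → Fin n, Function.Injective a ∧
      ∀ i j k : Fin 4, i ≠ j → i ≠ k → j ≠ k →
        LinearIndependent ℝ ![p (a i), p (a j), p (a k)])
    (k : Fin n → ℝ) (hk : ∀ i, 0 < k i)
    (E : Matrix (Fin 3) (Fin 3) ℝ) (hdet : E.det = 1)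
    (hcost : ∑ i, (k i / 2) *
      eNorm3 ((eNorm3 (E.mulVec (p i)))⁻¹ • E.mulVec (p i) - p i) ^ 2 = 0) :
    E = 1 := by
  obtain ⟨a, -, ha⟩ := hcons
  have hp : ∀ i, p i ≠ 0 := fun i h => by
    have h1 := hunit i
    rw [eNorm3_eq_zero.mpr h] at h1
    exact zero_ne_one h1
  choose c hc using exists_mulVec_eq_smul_of_cost_eq_zero hp hk hcost
  have hE := eq_smul_one_of_four_eigenvectors (v := p ∘ a) ha (c := c ∘ a) fun i => hc (a i)
  rw [hE, det_smul, det_one, mul_one, Fintype.card_fin] at hdet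
  have hc1 : (c ∘ a) 3 = 1 := (show Odd 3 by decide).strictMono_pow.injective (by simpa using hdet)
  rw [hE, hc1, one_smul]
end

section
/- Fix unit vectors p̊₁, …, p̊ₙ ∈ ℝ³, nonzero vectors p₁, …, pₙ ∈ ℝ³, and scalars k₁, …, kₙ ∈ ℝ. For an invertible real 3×3 matrix Ĥ define eᵢ(Ĥ, p) := Ĥ pᵢ/‖Ĥ pᵢ‖ and the innovation Δ(Ĥ, p) := −Σᵢ kᵢ (I − eᵢeᵢᵀ) p̊ᵢ eᵢᵀ. Then for every invertible real 3×3 matrix Q, replacing Ĥ by ĤQ and each pᵢ by ρ(Q, pᵢ) := Q⁻¹pᵢ/‖Q⁻¹pᵢ‖ leaves the innovation unchanged: Δ(ĤQ, ρ(Q,p)) = Δ(Ĥ, p). (Right equivariance of the innovation term.) -/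
open Matrix

/-- Normalization `x ↦ x/‖x‖`. -/
noncomputable def unitize (x : Fin 3 → ℝ) : Fin 3 → ℝ := (eNorm3 x)⁻¹ • x

/-- The innovation term `Δ = −∑ᵢ kᵢ (I − eᵢeᵢᵀ) p̊ᵢ eᵢᵀ` built from directions `eᵢ`,
reference directions `p̊ᵢ` and gains `kᵢ`. -/
noncomputable def innovation {n : ℕ} (k : Fin n → ℝ) (pr e : Fin n → Fin 3 → ℝ) :
    Matrix (Fin 3) (Fin 3) ℝ :=
  -∑ i, k i • vecMulVec ((1 - vecMulVec (e i) (e i)).mulVec (pr i)) (e i)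

theorem eNorm3_smul {c : ℝ} (hc : 0 ≤ c) (x : Fin 3 → ℝ) : eNorm3 (c • x) = c * eNorm3 x := by
  simp only [eNorm3, smul_dotProduct, dotProduct_smul, smul_eq_mul]
  rw [← mul_assoc, Real.sqrt_mul (mul_self_nonneg c), Real.sqrt_mul_self hc]

theorem eNorm3_pos {x : Fin 3 → ℝ} (hx : x ≠ 0) : 0 < eNorm3 x := by
  have h : 0 ≤ x ⬝ᵥ x := Finset.sum_nonneg fun i _ => mul_self_nonneg (x i)
  exact Real.sqrt_pos.2 (h.lt_of_ne' (mt dotProduct_self_eq_zero.1 hx))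

theorem unitize_smul {c : ℝ} (hc : 0 < c) (x : Fin 3 → ℝ) : unitize (c • x) = unitize x := by
  rw [unitize, unitize, eNorm3_smul hc.le, smul_smul, _root_.mul_inv_rev,
    inv_mul_cancel_right₀ hc.ne']

/-- right equivariance of the innovation term: replacing `Ĥ` by `ĤQ` and
each `pᵢ` by `ρ(Q, pᵢ) = Q⁻¹pᵢ/‖Q⁻¹pᵢ‖` leaves `Δ(Ĥ, p) = −∑ᵢ kᵢ π_{eᵢ} p̊ᵢ eᵢᵀ`
(with `eᵢ = Ĥpᵢ/‖Ĥpᵢ‖`) unchanged. -/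
theorem stmt_7 (n : ℕ) (pr p : Fin n → Fin 3 → ℝ)
    (hpr : ∀ i, eNorm3 (pr i) = 1) (hp : ∀ i, p i ≠ 0) (k : Fin n → ℝ)
    (Hh Q : Matrix (Fin 3) (Fin 3) ℝ) (hH : IsUnit Hh.det) (hQ : IsUnit Q.det) :
    innovation k pr (fun i => unitize ((Hh * Q).mulVec (unitize (Q⁻¹.mulVec (p i))))) =
      innovation k pr (fun i => unitize (Hh.mulVec (p i))) := by
  congr 1
  funext i
  have hq : Q⁻¹ *ᵥ p i ≠ 0 := fun h => hp i <| by
    rw [← one_mulVec (p i), ← mul_nonsing_inv Q hQ, ← mulVec_mulVec, h, mulVec_zero]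
  rw [unitize.eq_def (Q⁻¹ *ᵥ p i), mulVec_smul, unitize_smul (inv_pos.2 (eNorm3_pos hq)),
    mulVec_mulVec, mul_assoc, mul_nonsing_inv Q hQ, mul_one]
end

section
/- Let H, Ĥ : ℝ → M₃(ℝ) be curves of real 3×3 matrices, U, Δ : ℝ → M₃(ℝ), and t ∈ ℝ. Assume H is differentiable at t with derivative H(t)·U(t), Ĥ is differentiable at t with derivative Ĥ(t)·U(t) − Δ(t)·Ĥ(t), and H(t) is invertible. Then the group error E(s) := Ĥ(s)·H(s)⁻¹ is differentiable at t with derivative E′(t) = −Δ(t)·E(t). -/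
open Matrix

attribute [local instance] Matrix.normedAddCommGroup Matrix.normedSpace

/-- The derivative of `g * f⁻¹` in a complete normed algebra, for `f' = f u` and
`g' = g u - d g`. -/
theorem HasDerivAt.mul_ringInverse_of_error {R : Type*} [NormedRing R] [NormedAlgebra ℝ R]
    [HasSummableGeomSeries R] {f g : ℝ → R} {u d : R} {t : ℝ}
    (hf : HasDerivAt f (f t * u) t) (hg : HasDerivAt g (g t * u - d * g t) t)
    (hft : IsUnit (f t)) :
    HasDerivAt (fun s => g s * Ring.inverse (f s)) (-(d * (g t * Ring.inverse (f t)))) t := by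
  obtain ⟨x, hx⟩ := hft
  have hinv := hasFDerivAt_ringInverse (𝕜 := ℝ) x
  rw [hx] at hinv
  have h := hg.mul (hinv.comp_hasDerivAt t hf)
  refine h.congr_deriv ?_
  simp only [Function.comp_apply, ← hx, Ring.inverse_unit, _root_.neg_apply,
    ContinuousLinearMap.mulLeftRight_apply, Units.inv_mul_cancel_left]
  noncomm_ring

/-- if `Ḣ = HU`, `Ĥ̇ = ĤU − ΔĤ` and `H(t)` is invertible, the group error
`E = ĤH⁻¹` evolves as `Ė = −ΔE`. -/
theorem stmt_10 (H Hh U Δ : ℝ → Matrix (Fin 3) (Fin 3) ℝ) (t : ℝ)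
    (hH : HasDerivAt H (H t * U t) t)
    (hHh : HasDerivAt Hh (Hh t * U t - Δ t * Hh t) t)
    (hinv : IsUnit (H t).det) :
    HasDerivAt (fun s => Hh s * (H s)⁻¹) (-(Δ t * (Hh t * (H t)⁻¹))) t := by
  simp only [nonsing_inv_eq_ringInverse]
  let _ : NormedRing (Matrix (Fin 3) (Fin 3) ℝ) := Matrix.linftyOpNormedRing
  let _ : NormedAlgebra ℝ (Matrix (Fin 3) (Fin 3) ℝ) := Matrix.linftyOpNormedAlgebra
  have : HasSummableGeomSeries (Matrix (Fin 3) (Fin 3) ℝ) :=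
    @instHasSummableGeomSeriesOfCompleteSpace _ _ (FiniteDimensional.complete ℝ _)
  exact HasDerivAt.mul_ringInverse_of_error hH hHh ((isUnit_iff_isUnit_det _).2 hinv)
end

section
/- Let e₁, …, eₙ ∈ ℝ³ be unit vectors, p̊₁, …, p̊ₙ ∈ ℝ³ arbitrary, k₁, …, kₙ ∈ ℝ, and set Δ := −Σᵢ kᵢ (I − eᵢeᵢᵀ) p̊ᵢ eᵢᵀ. Then Σᵢ kᵢ ⟨eᵢ − p̊ᵢ, (I − eᵢeᵢᵀ)(Δ eᵢ)⟩ = ‖Δ‖²_F, where ‖Δ‖²_F = trace(ΔᵀΔ) is the squared Frobenius norm. Consequently, along the error flow Ė = −ΔE the Lyapunov function L₀ = Σᵢ (kᵢ/2)‖eᵢ − p̊ᵢ‖² satisfies L̇₀ = −‖Δ‖²_F. -/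
open Matrix

/-- The projection `I - x xᵀ` is self-adjoint for the dot product. -/
lemma dotProduct_one_sub_vecMulVec_mulVec {m R : Type*} [Fintype m] [DecidableEq m] [CommRing R]
    (x u v : m → R) :
    u ⬝ᵥ (1 - vecMulVec x x) *ᵥ v = (1 - vecMulVec x x) *ᵥ u ⬝ᵥ v := by
  rw [dotProduct_mulVec, ← mulVec_transpose, transpose_sub, transpose_one, transpose_vecMulVec]

/-- For `x` of unit length, the projection `I - x xᵀ` kills `x`. -/
lemma one_sub_vecMulVec_mulVec_self {m R : Type*} [Fintype m] [DecidableEq m] [CommRing R]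
    {x : m → R} (hx : x ⬝ᵥ x = 1) : (1 - vecMulVec x x) *ᵥ x = 0 := by
  simp [sub_mulVec, vecMulVec_mulVec, hx]

/-- with unit vectors `eᵢ` and `Δ = −∑ᵢ kᵢ (I − eᵢeᵢᵀ) p̊ᵢ eᵢᵀ`, one has
`∑ᵢ kᵢ ⟨eᵢ − p̊ᵢ, (I − eᵢeᵢᵀ)(Δ eᵢ)⟩ = ‖Δ‖²_F = trace(ΔᵀΔ)` (so that along the error
flow `Ė = −ΔE` the Lyapunov function `L₀ = ∑ᵢ (kᵢ/2)‖eᵢ − p̊ᵢ‖²` satisfies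
`L̇₀ = −‖Δ‖²_F`). -/
theorem stmt_11 (n : ℕ) (e pr : Fin n → Fin 3 → ℝ)
    (he : ∀ i, eNorm3 (e i) = 1) (k : Fin n → ℝ)
    (Δ : Matrix (Fin 3) (Fin 3) ℝ)
    (hΔ : Δ = -∑ i, k i • vecMulVec ((1 - vecMulVec (e i) (e i)).mulVec (pr i)) (e i)) :
    ∑ i, k i * ((e i - pr i) ⬝ᵥ (1 - vecMulVec (e i) (e i)).mulVec (Δ.mulVec (e i)))
      = (Δᵀ * Δ).trace := by
  have hterm (i : Fin n) :
      (e i - pr i) ⬝ᵥ (1 - vecMulVec (e i) (e i)) *ᵥ (Δ *ᵥ e i)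
        = -((1 - vecMulVec (e i) (e i)) *ᵥ pr i ⬝ᵥ Δ *ᵥ e i) := by
    have hunit : e i ⬝ᵥ e i = 1 := Real.sqrt_eq_one.mp (he i)
    rw [dotProduct_one_sub_vecMulVec_mulVec, mulVec_sub, one_sub_vecMulVec_mulVec_self hunit,
      zero_sub, neg_dotProduct]
  have htrace : (Δᵀ * Δ).trace
      = (Δᵀ * -∑ i, k i • vecMulVec ((1 - vecMulVec (e i) (e i)) *ᵥ pr i) (e i)).trace := by
    rw [← hΔ]
  simp_rw [htrace, hterm, Matrix.mul_neg, Matrix.mul_sum, trace_neg, trace_sum, Matrix.mul_smul,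
    trace_smul, mul_vecMulVec, trace_vecMulVec, mulVec_transpose, ← dotProduct_mulVec, mul_neg,
    Finset.sum_neg_distrib, smul_eq_mul]
end

section
/- Let E be an invertible real 3×3 matrix, p̊₁, …, p̊ₙ ∈ ℝ³ nonzero, and k₁, …, kₙ ≥ 0. Set eᵢ := E p̊ᵢ/‖E p̊ᵢ‖ and Δ := −Σᵢ kᵢ (I − eᵢeᵢᵀ) p̊ᵢ eᵢᵀ. Then trace(−Δ·(E⁻¹)ᵀ) = Σᵢ kᵢ (‖E p̊ᵢ‖²·‖p̊ᵢ‖² − ⟨E p̊ᵢ, p̊ᵢ⟩²)/‖E p̊ᵢ‖³, and in particular trace(−Δ·(E⁻¹)ᵀ) ≥ 0. -/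
open Matrix

theorem eNorm3_sq (x : Fin 3 → ℝ) : eNorm3 x ^ 2 = x ⬝ᵥ x :=
  Real.sq_sqrt (by simpa using dotProduct_star_self_nonneg x)

/-- The Cauchy–Schwarz inequality for `eNorm3`. -/
theorem sq_dotProduct_le_eNorm3_sq_mul (x y : Fin 3 → ℝ) :
    (x ⬝ᵥ y) ^ 2 ≤ eNorm3 x ^ 2 * eNorm3 y ^ 2 := by
  rw [eNorm3_sq, eNorm3_sq]
  simpa [dotProduct, sq] using Finset.sum_mul_sq_le_sq_mul_sq Finset.univ x y

/-- The trace of a single innovation summand `π_e p eᵀ` against `E⁻ᵀ`, where `e = E p / ‖E p‖`. -/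
theorem trace_vecMulVec_unitize_mul_inv_transpose {E : Matrix (Fin 3) (Fin 3) ℝ}
    (hE : IsUnit E.det) {p : Fin 3 → ℝ} (hp : E *ᵥ p ≠ 0) :
    (vecMulVec ((1 - vecMulVec (unitize (E *ᵥ p)) (unitize (E *ᵥ p))) *ᵥ p)
        (unitize (E *ᵥ p)) * E⁻¹ᵀ).trace =
      (eNorm3 (E *ᵥ p) ^ 2 * eNorm3 p ^ 2 - (E *ᵥ p ⬝ᵥ p) ^ 2) / eNorm3 (E *ᵥ p) ^ 3 := by
  have hpos := eNorm3_pos hp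
  have hinv : E⁻¹ *ᵥ (E *ᵥ p) = p := by
    rw [mulVec_mulVec, nonsing_inv_mul _ hE, one_mulVec]
  rw [vecMulVec_mul, vecMul_transpose, trace_vecMulVec, unitize, mulVec_smul, hinv, sub_mulVec,
    one_mulVec, vecMulVec_mulVec, eNorm3_sq p]
  simp only [dotProduct_smul, sub_dotProduct, smul_dotProduct, op_smul_eq_smul, smul_eq_mul]
  field_simp

/-- with `eᵢ = E p̊ᵢ/‖E p̊ᵢ‖` and `Δ = −∑ᵢ kᵢ (I − eᵢeᵢᵀ) p̊ᵢ eᵢᵀ`, one has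
`trace(−Δ (E⁻¹)ᵀ) = ∑ᵢ kᵢ (‖E p̊ᵢ‖²‖p̊ᵢ‖² − ⟨E p̊ᵢ, p̊ᵢ⟩²)/‖E p̊ᵢ‖³ ≥ 0`. -/
theorem stmt_12 (n : ℕ) (E : Matrix (Fin 3) (Fin 3) ℝ) (hE : IsUnit E.det)
    (pr : Fin n → Fin 3 → ℝ) (hpr : ∀ i, pr i ≠ 0)
    (k : Fin n → ℝ) (hk : ∀ i, 0 ≤ k i)
    (e : Fin n → Fin 3 → ℝ) (he : ∀ i, e i = unitize (E.mulVec (pr i)))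
    (Δ : Matrix (Fin 3) (Fin 3) ℝ)
    (hΔ : Δ = -∑ i, k i • vecMulVec ((1 - vecMulVec (e i) (e i)).mulVec (pr i)) (e i)) :
    (-Δ * E⁻¹ᵀ).trace =
        ∑ i, k i * ((eNorm3 (E.mulVec (pr i))) ^ 2 * (eNorm3 (pr i)) ^ 2
          - (E.mulVec (pr i) ⬝ᵥ pr i) ^ 2) / (eNorm3 (E.mulVec (pr i))) ^ 3 ∧
      0 ≤ (-Δ * E⁻¹ᵀ).trace := by
  have hne (i : Fin n) : E *ᵥ pr i ≠ 0 := fun h =>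
    hpr i (mulVec_injective_of_isUnit ((isUnit_iff_isUnit_det E).2 hE) (by simpa using h))
  have htrace : (-Δ * E⁻¹ᵀ).trace =
      ∑ i, k i * ((eNorm3 (E.mulVec (pr i))) ^ 2 * (eNorm3 (pr i)) ^ 2
        - (E.mulVec (pr i) ⬝ᵥ pr i) ^ 2) / (eNorm3 (E.mulVec (pr i))) ^ 3 := by
    rw [hΔ, neg_neg, Finset.sum_mul, trace_sum]
    refine Finset.sum_congr rfl fun i _ => ?_
    rw [he, smul_mul, trace_smul, trace_vecMulVec_unitize_mul_inv_transpose hE (hne i),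
      smul_eq_mul, mul_div_assoc]
  refine ⟨htrace, htrace ▸ Finset.sum_nonneg fun i _ => ?_⟩
  exact div_nonneg (mul_nonneg (hk i) (sub_nonneg.2 (sq_dotProduct_le_eNorm3_sq_mul _ _)))
    (pow_nonneg (eNorm3_pos (hne i)).le 3)
end

section
/- Let H, Ĥ : ℝ → M₃(ℝ), let Ω, Γ, Γ̂, Δ : ℝ → M₃(ℝ), and t ∈ ℝ. Assume H is differentiable at t with derivative H(t)·(Ω(t) + Γ(t)), Ĥ is differentiable at t with derivative Ĥ(t)·(Ω(t) + Γ̂(t)) − Δ(t)·Ĥ(t), and H(t) is invertible. Then E(s) := Ĥ(s)·H(s)⁻¹ is differentiable at t with derivative E′(t) = −Δ(t)·E(t) − Ĥ(t)·(Γ(t) − Γ̂(t))·H(t)⁻¹. If in addition Ĥ(t) is invertible, this equals −(Δ(t) + Ĥ(t)·Γ̃(t)·Ĥ(t)⁻¹)·E(t), where Γ̃ := Γ − Γ̂. -/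
open Matrix

attribute [local instance] Matrix.normedAddCommGroup Matrix.normedSpace

/-- The derivative of `s ↦ g s * (f s)⁻¹ʳ` in a complete normed algebra, where `f t` is a unit. -/
theorem HasDerivAt.mul_ringInverse {𝕜 R : Type*} [NontriviallyNormedField 𝕜] [NormedRing R]
    [NormedAlgebra 𝕜 R] [HasSummableGeomSeries R] {f g : 𝕜 → R} {f' g' : R} {t : 𝕜}
    (hg : HasDerivAt g g' t) (hf : HasDerivAt f f' t) (hu : IsUnit (f t)) :
    HasDerivAt (fun s => g s * Ring.inverse (f s))
      (g' * Ring.inverse (f t) - g t * (Ring.inverse (f t) * f' * Ring.inverse (f t))) t := by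
  obtain ⟨u, hu⟩ := hu
  have hinverse : HasFDerivAt Ring.inverse _ (f t) := hu ▸ hasFDerivAt_ringInverse (𝕜 := 𝕜) u
  have h := hg.fun_mul (hinverse.comp_hasDerivAt t hf)
  simpa [Function.comp_def, ← hu, sub_eq_add_neg] using h

/-- The derivative of `s ↦ B s * (A s)⁻¹` for matrix-valued curves, where `A t` is invertible. -/
theorem Matrix.hasDerivAt_mul_inv {n : Type*} [Fintype n] [DecidableEq n]
    {A B : ℝ → Matrix n n ℝ} {A' B' : Matrix n n ℝ} {t : ℝ}
    (hB : HasDerivAt B B' t) (hA : HasDerivAt A A' t) (hu : IsUnit (A t).det) :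
    HasDerivAt (fun s => B s * (A s)⁻¹)
      (B' * (A t)⁻¹ - B t * ((A t)⁻¹ * A' * (A t)⁻¹)) t := by
  simp only [nonsing_inv_eq_ringInverse]
  exact @HasDerivAt.mul_ringInverse ℝ (Matrix n n ℝ) _ Matrix.linftyOpNormedRing
    Matrix.linftyOpNormedAlgebra inferInstance A B A' B' t hB hA
    ((Matrix.isUnit_iff_isUnit_det _).2 hu)

/-- if `Ḣ = H(Ω + Γ)`, `Ĥ̇ = Ĥ(Ω + Γ̂) − ΔĤ` and `H(t)` is invertible, the
error `E = ĤH⁻¹` evolves as `Ė = −ΔE − Ĥ(Γ − Γ̂)H⁻¹`; if moreover `Ĥ(t)` is invertible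
this equals `−(Δ + Ĥ Γ̃ Ĥ⁻¹)E` with `Γ̃ = Γ − Γ̂`. -/
theorem stmt_18 (H Hh Ω Γ Γh Δ : ℝ → Matrix (Fin 3) (Fin 3) ℝ) (t : ℝ)
    (hH : HasDerivAt H (H t * (Ω t + Γ t)) t)
    (hHh : HasDerivAt Hh (Hh t * (Ω t + Γh t) - Δ t * Hh t) t)
    (hinv : IsUnit (H t).det) :
    HasDerivAt (fun s => Hh s * (H s)⁻¹)
        (-(Δ t * (Hh t * (H t)⁻¹)) - Hh t * (Γ t - Γh t) * (H t)⁻¹) t ∧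
      (IsUnit (Hh t).det →
        -(Δ t * (Hh t * (H t)⁻¹)) - Hh t * (Γ t - Γh t) * (H t)⁻¹ =
          -((Δ t + Hh t * (Γ t - Γh t) * (Hh t)⁻¹) * (Hh t * (H t)⁻¹))) := by
  refine ⟨?_, fun hu => ?_⟩
  · convert Matrix.hasDerivAt_mul_inv hHh hH hinv using 1
    rw [← Matrix.mul_assoc (H t)⁻¹, Matrix.nonsing_inv_mul _ hinv, Matrix.one_mul]
    noncomm_ring
  · rw [Matrix.add_mul, Matrix.mul_assoc _ (Hh t)⁻¹, ← Matrix.mul_assoc (Hh t)⁻¹,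
      Matrix.nonsing_inv_mul _ hu, Matrix.one_mul, neg_add, sub_eq_add_neg]
end

section
/- Let e₁, …, eₙ ∈ ℝ³ be unit vectors, p̊₁, …, p̊ₙ ∈ ℝ³ arbitrary, k₁, …, kₙ ∈ ℝ, let Ĥ be an invertible real 3×3 matrix and Γ̃ any real 3×3 matrix. Set Δ := −Σᵢ kᵢ (I − eᵢeᵢᵀ) p̊ᵢ eᵢᵀ and B := Ĥ·Γ̃·Ĥ⁻¹. Then −Σᵢ kᵢ ⟨eᵢ − p̊ᵢ, (I − eᵢeᵢᵀ)((Δ + B) eᵢ)⟩ + trace(Γ̃ᵀ·(Ĥᵀ·Δ·(Ĥ⁻¹)ᵀ)) = −‖Δ‖²_F, where ‖Δ‖²_F = trace(ΔᵀΔ). -/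
open Matrix

/-- The outer product `v xᵀ` represents the functional `M ↦ ⟨v, M x⟩` for the trace pairing. -/
lemma trace_transpose_mul_vecMulVec {m R : Type*} [Fintype m] [CommRing R]
    (M : Matrix m m R) (v x : m → R) :
    (Mᵀ * vecMulVec v x).trace = v ⬝ᵥ M *ᵥ x := by
  rw [mul_vecMulVec, trace_vecMulVec, mulVec_transpose, dotProduct_mulVec]

/-- The projection orthogonal to a unit vector `x` is self-adjoint and kills `x`. -/
lemma sub_dotProduct_orthogonalProjection_mulVec {m R : Type*} [Fintype m] [DecidableEq m]
    [CommRing R] {x : m → R} (hx : x ⬝ᵥ x = 1) (p w : m → R) :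
    (x - p) ⬝ᵥ (1 - vecMulVec x x) *ᵥ w = -((1 - vecMulVec x x) *ᵥ p ⬝ᵥ w) := by
  simp only [sub_mulVec, one_mulVec, vecMulVec_mulVec, op_smul_eq_smul, dotProduct_sub,
    sub_dotProduct, dotProduct_smul, smul_dotProduct, smul_eq_mul, hx, dotProduct_comm p x]
  ring

/-- with unit vectors `eᵢ`, `Δ = −∑ᵢ kᵢ (I − eᵢeᵢᵀ) p̊ᵢ eᵢᵀ`, an invertible
`Ĥ`, any `Γ̃` and `B = Ĥ Γ̃ Ĥ⁻¹`, one has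
`−∑ᵢ kᵢ ⟨eᵢ − p̊ᵢ, (I − eᵢeᵢᵀ)((Δ + B) eᵢ)⟩ + trace(Γ̃ᵀ (Ĥᵀ Δ (Ĥ⁻¹)ᵀ)) = −‖Δ‖²_F`. -/
theorem stmt_19 (n : ℕ) (e pr : Fin n → Fin 3 → ℝ)
    (he : ∀ i, eNorm3 (e i) = 1) (k : Fin n → ℝ)
    (Hh : Matrix (Fin 3) (Fin 3) ℝ) (hH : IsUnit Hh.det)
    (Γt : Matrix (Fin 3) (Fin 3) ℝ)
    (Δ : Matrix (Fin 3) (Fin 3) ℝ)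
    (hΔ : Δ = -∑ i, k i • vecMulVec ((1 - vecMulVec (e i) (e i)).mulVec (pr i)) (e i))
    (B : Matrix (Fin 3) (Fin 3) ℝ) (hB : B = Hh * Γt * Hh⁻¹) :
    -∑ i, k i * ((e i - pr i) ⬝ᵥ
        (1 - vecMulVec (e i) (e i)).mulVec ((Δ + B).mulVec (e i)))
      + (Γtᵀ * (Hhᵀ * Δ * Hh⁻¹ᵀ)).trace = -(Δᵀ * Δ).trace := by
  have hunit : ∀ i, e i ⬝ᵥ e i = 1 := fun i => Real.sqrt_eq_one.mp (he i)
  have hsum : ∀ M : Matrix (Fin 3) (Fin 3) ℝ, ∑ i, k i * ((e i - pr i) ⬝ᵥ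
      (1 - vecMulVec (e i) (e i)) *ᵥ (M *ᵥ e i)) = (Mᵀ * Δ).trace := by
    intro M
    rw [hΔ, Matrix.mul_neg, Matrix.mul_sum, trace_neg, trace_sum, ← Finset.sum_neg_distrib]
    refine Finset.sum_congr rfl fun i _ => ?_
    rw [sub_dotProduct_orthogonalProjection_mulVec (hunit i), Matrix.mul_smul, trace_smul,
      trace_transpose_mul_vecMulVec, smul_eq_mul, mul_neg]
  have hadj : (Γtᵀ * (Hhᵀ * Δ * Hh⁻¹ᵀ)).trace = (Bᵀ * Δ).trace := by
    rw [hB, ← Matrix.mul_assoc, trace_mul_comm]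
    simp only [transpose_mul, Matrix.mul_assoc]
  rw [hsum, hadj, transpose_add, Matrix.add_mul, trace_add]
  ring
end
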